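/- Let L be a finite simplicial complex on vertex set V, k a field, and W ⊆ V. Then β_i(k⟨L⟩, W) = Σ_{σ ∈ L_{V∖W}} dim_k H̃_{i−1−|σ|}(lk_{L_W}(σ), k), where the sum ranges over all simplices σ of the induced subcomplex L_{V∖W}, including the empty simplex with the conventions |∅| = 0 and H̃_{−1}(∅, k) = k. -/

import Mathlib

open Finset

variable {V : Type} [Fintype V] [LinearOrder V]

/-- The set of faces of cardinality `c` of a finite family of finsets `L`
(for a simplicial complex, these index the `(c-1)`-simplices, with the empty
simplex corresponding to `c = 0`). -/
abbrev Face (L : Finset (Finset V)) (c : ℕ) := {σ : Finset V // σ ∈ L ∧ σ.card = c}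

/-- `L` is (the face set of) a finite abstract simplicial complex:  it contains the
empty face and is closed under passing to subsets. -/
def IsCx (L : Finset (Finset V)) : Prop :=
  ∅ ∈ L ∧ ∀ σ ∈ L, ∀ τ ⊆ σ, τ ∈ L

/-- Incidence coefficient between a face `τ` and a face `σ` (intended: `τ ⊆ σ` with
`|σ| = |τ| + 1`), twisted by the weights `z`:  if `σ = τ ∪ {v}` this is
`(-1)^{#{w ∈ τ : w < v}} ⬝ z v`, and `0` if `τ ⊄ σ`. -/
def coeffD {R : Type} [CommRing R] (z : V → R) (τ σ : Finset V) : R :=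
  if τ ⊆ σ then ∑ v ∈ σ \ τ, (-1 : R) ^ (τ.filter (fun w => w < v)).card * z v else 0

/-- The boundary map `∂^z : C_{c+1}(T_L, R_z) → C_c(T_L, R_z)` of the twisted cellular
chain complex of the toric complex `T_L`:  on a basis element `c_σ`,
`σ = {v_1 < ⋯ < v_{c+1}}`, it is `∂^z c_σ = ∑ (-1)^{r-1} z_{v_r} c_{σ ∖ {v_r}}`. -/
noncomputable def tB (R : Type) [CommRing R] (L : Finset (Finset V)) (z : V → R) (c : ℕ) :
    (Face L (c+1) → R) →ₗ[R] (Face L c → R) :=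
  Matrix.mulVecLin (fun (τ : Face L c) (σ : Face L (c+1)) => coeffD z τ.1 σ.1)

/-- The Aomoto differential on the exterior Stanley--Reisner ring `k⟨L⟩`:  the degree-`c`
piece of `k⟨L⟩` has basis the faces of cardinality `c`, and right multiplication by
`z = ∑ z_v v*` sends the monomial `e_τ` to `∑_{v : τ ∪ {v} ∈ L} ± z_v e_{τ ∪ {v}}`. -/
noncomputable def aD (k : Type) [Field k] (L : Finset (Finset V)) (z : V → k) (c : ℕ) :
    (Face L c → k) →ₗ[k] (Face L (c+1) → k) :=
  Matrix.mulVecLin (fun (σ : Face L (c+1)) (τ : Face L c) => coeffD z τ.1 σ.1)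

/-- The Aomoto--Betti number `β_i(k⟨L⟩, z)`, the dimension of the `i`-th cohomology
of the Aomoto complex `(k⟨L⟩, ·z)`. -/
noncomputable def aomotoBetti (k : Type) [Field k] (L : Finset (Finset V)) (z : V → k)
    (i : ℕ) : ℕ :=
  Module.finrank k (LinearMap.ker (aD k L z i)) -
    (match i with
     | 0 => 0
     | j+1 => Module.finrank k (LinearMap.range (aD k L z j)))

/-- The canonical degree-one element `z_W = ∑_{v ∈ W} v*` of `k⟨L⟩`, as a weight vector. -/
def zW (k : Type) [Field k] (W : Finset V) : V → k := fun v => if v ∈ W then 1 else 0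

/-- The Aomoto--Betti number `β_i(k⟨L⟩, W) = β_i(k⟨L⟩, z_W)`. -/
noncomputable def aomotoBettiW (k : Type) [Field k] (L : Finset (Finset V)) (W : Finset V)
    (i : ℕ) : ℕ :=
  aomotoBetti k L (zW k W) i

/-- The cycles in cardinality-degree `n` of the twisted chain complex `C_•(T_L, R_z)`
(in degree `0` every chain is a cycle). -/
noncomputable def cyc (R : Type) [CommRing R] (L : Finset (Finset V)) (z : V → R) :
    (n : ℕ) → Submodule R (Face L n → R)
  | 0 => ⊤
  | (m+1) => LinearMap.ker (tB R L z m)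

/-- `dim_k H_n(C_•(T_L, k_z))`, the dimension of the `n`-th twisted homology of the
toric complex `T_L` with coefficients in the rank-one system determined by `z`. -/
noncomputable def twHomDim (k : Type) [Field k] (L : Finset (Finset V)) (z : V → k)
    (n : ℕ) : ℕ :=
  Module.finrank k ↥(cyc k L z n) - Module.finrank k ↥(LinearMap.range (tB k L z n))

/-- `dim_k H̃_j(K; k)`, the `j`-th reduced simplicial homology of the complex `K`
(the chain complex of `K` including the empty face is exactly the twisted complex
with all weights equal to `1`; the degree-`j` reduced homology sits in
cardinality-degree `j+1`). -/
noncomputable def reducedBetti (k : Type) [Field k] (K : Finset (Finset V)) (j : ℤ) : ℕ :=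
  if j < -1 then 0 else twHomDim k K (fun _ => (1 : k)) (j+1).toNat

/-- The link `lk_{L_W}(σ) = {τ ∈ L_W ∣ τ ∪ σ ∈ L}` of a face `σ` in the induced
subcomplex `L_W`. -/
def linkIn (L : Finset (Finset V)) (W σ : Finset V) : Finset (Finset V) :=
  L.filter (fun τ => τ ⊆ W ∧ τ ∪ σ ∈ L)

/-- The `n`-th homology of the twisted chain complex `C_•(T_L, R_z)`, as an `R`-module. -/
noncomputable def twHomology (R : Type) [CommRing R] (L : Finset (Finset V)) (z : V → R)
    (n : ℕ) :=
  ↥(cyc R L z n) ⧸ (LinearMap.range (tB R L z n)).comap (cyc R L z n).subtype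

set_option linter.unusedSectionVars false

namespace Matrix

/-- The rank of a block diagonal matrix is the sum of the ranks of its blocks. -/
theorem rank_blockDiagonal' {K ι : Type*} [Field K] [Fintype ι] [DecidableEq ι]
    {m n : ι → Type*} [∀ i, Fintype (m i)] [∀ i, Fintype (n i)]
    (M : ∀ i, Matrix (m i) (n i) K) :
    (blockDiagonal' M).rank = ∑ i, (M i).rank := by
  set f : (∀ i, n i → K) →ₗ[K] (∀ i, m i → K) :=
    LinearMap.piMap fun i => (M i).mulVecLin with hf
  let em := LinearEquiv.piCurry K (fun (i : ι) (_ : m i) => K)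
  let en := LinearEquiv.piCurry K (fun (i : ι) (_ : n i) => K)
  have h1 : (em : _ →ₗ[K] _) ∘ₗ (blockDiagonal' M).mulVecLin = f ∘ₗ (en : _ →ₗ[K] _) := by
    refine LinearMap.ext fun x => ?_
    funext i j
    change ∑ p : (Σ i, n i), blockDiagonal' M ⟨i, j⟩ p * x p = ∑ l, M i j l * x ⟨i, l⟩
    rw [Fintype.sum_sigma, Finset.sum_eq_single i]
    · simp
    · intro b _ hb
      exact Finset.sum_eq_zero fun l _ => by
        rw [blockDiagonal'_apply_ne _ _ _ hb.symm, zero_mul]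
    · simp
  have h2 : (blockDiagonal' M).rank = Module.finrank K (LinearMap.range f) := by
    have h3 := congrArg LinearMap.range h1
    rw [LinearMap.range_comp, LinearMap.range_comp, LinearEquiv.range, Submodule.map_top] at h3
    rw [← h3]
    exact (LinearEquiv.finrank_map_eq em _).symm
  let g : (∀ i, LinearMap.range (M i).mulVecLin) →ₗ[K] (∀ i, m i → K) :=
    LinearMap.piMap fun i => (LinearMap.range (M i).mulVecLin).subtype
  have hg : Function.Injective g := fun a b h =>
    funext fun i => Subtype.ext (congrFun h i)
  have hfg : LinearMap.range f = LinearMap.range g := by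
    ext y
    constructor
    · rintro ⟨x, rfl⟩
      exact ⟨fun i => ⟨(M i).mulVecLin (x i), x i, rfl⟩, rfl⟩
    · rintro ⟨x, rfl⟩
      choose w hw using fun i => (x i).2
      exact ⟨w, funext hw⟩
  rw [h2, hfg, LinearMap.finrank_range_of_inj hg, Module.finrank_pi_fintype]
  rfl

end Matrix

section Coefficients

variable {R : Type} [CommRing R]

theorem coeffD_insert (z : V → R) {τ : Finset V} {v : V} (hv : v ∉ τ) :
    coeffD z τ (insert v τ) = (-1) ^ (τ.filter (fun w => w < v)).card * z v := by
  have h : insert v τ \ τ = {v} := by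
    ext x; simp only [mem_sdiff, mem_insert, mem_singleton]; grind
  rw [coeffD, if_pos (subset_insert v τ), h, sum_singleton]

theorem coeffD_of_not_subset (z : V → R) {τ σ : Finset V} (h : ¬ τ ⊆ σ) :
    coeffD z τ σ = 0 := if_neg h

/-- The two paths from `ρ` to `ρ ∪ {a, b}` cancel. -/
theorem coeffD_diamond (z : V → R) {ρ : Finset V} {a b : V} (ha : a ∉ ρ) (hb : b ∉ ρ)
    (hab : a < b) :
    coeffD z ρ (insert a ρ) * coeffD z (insert a ρ) (insert b (insert a ρ)) +
      coeffD z ρ (insert b ρ) * coeffD z (insert b ρ) (insert a (insert b ρ)) = 0 := by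
  have hb' : b ∉ insert a ρ := by simp [hb, hab.ne']
  have ha' : a ∉ insert b ρ := by simp [ha, hab.ne]
  rw [coeffD_insert z ha, coeffD_insert z hb, coeffD_insert z hb', coeffD_insert z ha',
    filter_insert, filter_insert, if_pos hab, if_neg hab.not_gt,
    card_insert_of_notMem (by simp [ha]), pow_succ]
  ring

/-- The sign obtained by moving the face `σ` past the face `ρ`. -/
def shuffleSign (R : Type) [CommRing R] (σ ρ : Finset V) : R :=
  ∏ v ∈ ρ, (-1 : R) ^ (σ.filter (fun w => w < v)).card

theorem shuffleSign_mul_self (σ ρ : Finset V) :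
    shuffleSign R σ ρ * shuffleSign R σ ρ = 1 := by
  rw [shuffleSign, ← prod_mul_distrib]
  exact prod_eq_one fun v _ => by rw [← mul_pow]; simp

end Coefficients

section Blocks

variable {k : Type} [Field k]

theorem coeffD_zW_union (W : Finset V) {σ ρ ρ' : Finset V}
    (hσ : Disjoint σ W) (hρ : ρ ⊆ W) (hρ' : ρ' ⊆ W) (hc : ρ'.card = ρ.card + 1) :
    coeffD (zW k W) (ρ ∪ σ) (ρ' ∪ σ) =
      shuffleSign k σ ρ' * coeffD (fun _ => (1 : k)) ρ ρ' * shuffleSign k σ ρ := by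
  have hd : ∀ τ ⊆ W, Disjoint τ σ := fun τ h => (hσ.mono_right h).symm
  by_cases h : ρ ⊆ ρ'
  · obtain ⟨v, hv, rfl⟩ : ∃ v, v ∉ ρ ∧ insert v ρ = ρ' :=
      (covBy_iff_exists_insert.1 (covBy_iff_card_sdiff_eq_one.2
        ⟨h, by rw [card_sdiff_of_subset h]; omega⟩))
    have hvW : v ∈ W := hρ' (mem_insert_self v ρ)
    have hvσ : v ∉ σ := fun h' => disjoint_left.1 hσ h' hvW
    rw [insert_union, coeffD_insert _ (by simp [hv, hvσ]), coeffD_insert _ hv, filter_union,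
      card_union_of_disjoint (disjoint_filter_filter (hd ρ hρ)), zW, if_pos hvW]
    have hs : shuffleSign k σ (insert v ρ) =
        (-1) ^ (σ.filter (fun w => w < v)).card * shuffleSign k σ ρ := prod_insert hv
    rw [hs, pow_add]
    linear_combination (-(-1 : k) ^ (ρ.filter (fun w => w < v)).card *
      (-1 : k) ^ (σ.filter (fun w => w < v)).card) * shuffleSign_mul_self (R := k) σ ρ
  · rw [coeffD_of_not_subset _ h, coeffD_of_not_subset]
    · simp
    · intro h'
      exact h fun x hx => (mem_union.1 (h' (mem_union_left σ hx))).resolve_right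
        (disjoint_left.1 (hd ρ hρ) hx)

theorem coeffD_zW_eq_zero (W : Finset V) {τ φ : Finset V} (hc : φ.card = τ.card + 1)
    (h : τ \ W ≠ φ \ W) : coeffD (zW k W) τ φ = 0 := by
  by_cases hs : τ ⊆ φ
  · obtain ⟨v, hv, rfl⟩ : ∃ v, v ∉ τ ∧ insert v τ = φ :=
      (covBy_iff_exists_insert.1 (covBy_iff_card_sdiff_eq_one.2
        ⟨hs, by rw [card_sdiff_of_subset hs]; omega⟩))
    have hvW : v ∉ W := fun hvW => h (insert_sdiff_of_mem τ hvW).symm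
    rw [coeffD_insert _ hv, zW, if_neg hvW, mul_zero]
  · exact coeffD_of_not_subset _ hs

/-- The faces `ρ` of the link of `σ` in `L_W` such that `ρ ∪ σ` has cardinality `c`. -/
abbrev LinkFace (L : Finset (Finset V)) (W σ : Finset V) (c : ℕ) :=
  {ρ : Finset V // ρ ∈ linkIn L W σ ∧ ρ.card + σ.card = c}

theorem linkFace_disjoint {L : Finset (Finset V)} {W σ : Finset V} {c : ℕ}
    (hσ : Disjoint σ W) (ρ : LinkFace L W σ c) : Disjoint ρ.1 σ :=
  (hσ.mono_right (mem_filter.1 ρ.2.1).2.1).symm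

/-- Joining a face of `L` disjoint from `W` with a face of its link in `L_W`. -/
def joinFace (L : Finset (Finset V)) (W : Finset V) (c : ℕ) :
    (Σ s : {σ // σ ∈ L.filter (fun σ => Disjoint σ W)}, LinkFace L W s.1 c) → Face L c :=
  fun p => ⟨p.2.1 ∪ p.1.1, (mem_filter.1 p.2.2.1).2.2, by
    rw [card_union_of_disjoint (linkFace_disjoint (mem_filter.1 p.1.2).2 p.2)]
    exact p.2.2.2⟩

theorem union_sdiff_eq {W σ ρ : Finset V} (hσ : Disjoint σ W) (hρ : ρ ⊆ W) :
    (ρ ∪ σ) \ W = σ := by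
  rw [union_sdiff_distrib, sdiff_eq_empty_iff_subset.2 hρ, empty_union,
    sdiff_eq_self_of_disjoint hσ]

theorem union_inter_eq {W σ ρ : Finset V} (hσ : Disjoint σ W) (hρ : ρ ⊆ W) :
    (ρ ∪ σ) ∩ W = ρ := by
  rw [union_inter_distrib_right, disjoint_iff_inter_eq_empty.1 hσ, union_empty,
    inter_eq_left.2 hρ]

theorem joinFace_bijective {L : Finset (Finset V)} (hL : IsCx L) (W : Finset V) (c : ℕ) :
    Function.Bijective (joinFace L W c) := by
  constructor
  · rintro ⟨⟨σ, hσ⟩, ⟨ρ, hρ⟩⟩ ⟨⟨σ', hσ'⟩, ⟨ρ', hρ'⟩⟩ h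
    have h1 : ρ ∪ σ = ρ' ∪ σ' := congrArg Subtype.val h
    have d := (mem_filter.1 hσ).2
    have d' := (mem_filter.1 hσ').2
    have s := (mem_filter.1 hρ.1).2.1
    have s' := (mem_filter.1 hρ'.1).2.1
    obtain rfl : σ = σ' := by
      rw [← union_sdiff_eq d s, h1, union_sdiff_eq d' s']
    obtain rfl : ρ = ρ' := by
      rw [← union_inter_eq d s, h1, union_inter_eq d' s']
    rfl
  · rintro ⟨φ, hφ, hc⟩
    have hu : φ ∩ W ∪ φ \ W = φ := by rw [union_comm, sdiff_union_inter]
    refine ⟨⟨⟨φ \ W, mem_filter.2 ⟨hL.2 φ hφ _ sdiff_subset, sdiff_disjoint⟩⟩,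
      ⟨φ ∩ W, mem_filter.2 ⟨hL.2 φ hφ _ inter_subset_left, inter_subset_right, ?_⟩, ?_⟩⟩,
      Subtype.ext hu⟩
    · rwa [hu]
    · rw [← hc, add_comm]; exact card_sdiff_add_card_inter φ W

/-- The block of the Aomoto differential belonging to `σ`, with unit weights. -/
def linkMatrix (k : Type) [Field k] (L : Finset (Finset V)) (W σ : Finset V) (c : ℕ) :
    Matrix (LinkFace L W σ (c + 1)) (LinkFace L W σ c) k :=
  fun ρ' ρ => coeffD (fun _ => 1) ρ.1 ρ'.1

/-- The block of the Aomoto differential belonging to `σ`, with the signs it carries in `L`. -/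
def signedLinkMatrix (k : Type) [Field k] (L : Finset (Finset V)) (W σ : Finset V) (c : ℕ) :
    Matrix (LinkFace L W σ (c + 1)) (LinkFace L W σ c) k :=
  fun ρ' ρ => shuffleSign k σ ρ'.1 * coeffD (fun _ => 1) ρ.1 ρ'.1 * shuffleSign k σ ρ.1

theorem card_face_eq_sum {L : Finset (Finset V)} (hL : IsCx L) (W : Finset V) (c : ℕ) :
    Fintype.card (Face L c) =
      ∑ σ ∈ L.filter (fun σ => Disjoint σ W), Fintype.card (LinkFace L W σ c) := by
  rw [← Fintype.card_of_bijective (joinFace_bijective hL W c), Fintype.card_sigma]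
  exact Finset.sum_coe_sort _ fun σ => Fintype.card (LinkFace L W σ c)

theorem rank_signedLinkMatrix (L : Finset (Finset V)) (W σ : Finset V) (c : ℕ) :
    (signedLinkMatrix k L W σ c).rank = (linkMatrix k L W σ c).rank := by
  have hu : ∀ d : ℕ, IsUnit
      (Matrix.diagonal fun ρ : LinkFace L W σ d => shuffleSign k σ ρ.1).det := by
    intro d
    rw [Matrix.det_diagonal, IsUnit.prod_univ_iff]
    exact fun ρ => IsUnit.of_mul_eq_one _ (shuffleSign_mul_self σ ρ.1)
  rw [← Matrix.rank_mul_eq_right_of_isUnit_det _ (linkMatrix k L W σ c) (hu (c + 1)),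
    ← Matrix.rank_mul_eq_left_of_isUnit_det _ (_ * linkMatrix k L W σ c) (hu c)]
  congr 1
  funext ρ' ρ
  rw [Matrix.mul_diagonal, Matrix.diagonal_mul]
  rfl

theorem finrank_range_aD_zW {L : Finset (Finset V)} (hL : IsCx L) (W : Finset V) (c : ℕ) :
    Module.finrank k (LinearMap.range (aD k L (zW k W) c)) =
      ∑ σ ∈ L.filter (fun σ => Disjoint σ W), (linkMatrix k L W σ c).rank := by
  let e := fun d => Equiv.ofBijective _ (joinFace_bijective hL W d)
  let M : Matrix (Face L (c + 1)) (Face L c) k := fun φ τ => coeffD (zW k W) τ.1 φ.1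
  change M.rank = _
  rw [← Matrix.rank_submatrix M (e (c + 1)) (e c), ← Finset.sum_coe_sort,
    ← Finset.sum_congr rfl fun s _ => rank_signedLinkMatrix L W s.1 c,
    ← Matrix.rank_blockDiagonal']
  congr 1
  funext ⟨s, ρ'⟩ ⟨t, ρ⟩
  have hs := (mem_filter.1 s.2).2
  have ht := (mem_filter.1 t.2).2
  have hρ := (mem_filter.1 ρ.2.1).2.1
  have hρ' := (mem_filter.1 ρ'.2.1).2.1
  change coeffD (zW k W) (ρ.1 ∪ t.1) (ρ'.1 ∪ s.1) = _
  by_cases h : s = t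
  · subst h
    rw [Matrix.blockDiagonal'_apply_eq]
    exact coeffD_zW_union W hs hρ hρ' (by have := ρ.2.2; have := ρ'.2.2; omega)
  · rw [Matrix.blockDiagonal'_apply_ne _ _ _ h]
    refine coeffD_zW_eq_zero W ?_ ?_
    · rw [card_union_of_disjoint (linkFace_disjoint ht ρ),
        card_union_of_disjoint (linkFace_disjoint hs ρ'), ρ.2.2, ρ'.2.2]
    · rw [union_sdiff_eq ht hρ, union_sdiff_eq hs hρ']
      exact fun h' => h (Subtype.ext h'.symm)

end Blocks

section Homology

variable {k : Type} [Field k]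

theorem isCx_linkIn {L : Finset (Finset V)} (hL : IsCx L) (W : Finset V) {σ : Finset V}
    (hσ : σ ∈ L) : IsCx (linkIn L W σ) := by
  refine ⟨mem_filter.2 ⟨hL.1, empty_subset W, by rwa [empty_union]⟩, fun φ hφ τ hτ => ?_⟩
  obtain ⟨h1, h2, h3⟩ := mem_filter.1 hφ
  exact mem_filter.2 ⟨hL.2 φ h1 τ hτ, hτ.trans h2, hL.2 _ h3 _ (union_subset_union_left hτ)⟩

/-- The boundary matrix of the twisted chain complex. -/
def boundaryMatrix {R : Type} [CommRing R] (K : Finset (Finset V)) (z : V → R) (c : ℕ) :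
    Matrix (Face K c) (Face K (c + 1)) R :=
  fun τ σ => coeffD z τ.1 σ.1

theorem boundaryMatrix_mul {R : Type} [CommRing R] {K : Finset (Finset V)} (hK : IsCx K)
    (z : V → R) (c : ℕ) : boundaryMatrix K z c * boundaryMatrix K z (c + 1) = 0 := by
  funext ρ σ
  change ∑ τ : Face K (c + 1), coeffD z ρ.1 τ.1 * coeffD z τ.1 σ.1 = 0
  by_cases h : ρ.1 ⊆ σ.1
  · have hcard : (σ.1 \ ρ.1).card = 2 := by
      rw [card_sdiff_of_subset h, σ.2.2, ρ.2.2]; omega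
    obtain ⟨a, b, hab, hσ⟩ : ∃ a b, a < b ∧ σ.1 \ ρ.1 = {a, b} := by
      obtain ⟨a, b, hne, h2⟩ := card_eq_two.1 hcard
      rcases hne.lt_or_gt with h3 | h3
      · exact ⟨a, b, h3, h2⟩
      · exact ⟨b, a, h3, by rw [h2, pair_comm]⟩
    have ha : a ∈ σ.1 \ ρ.1 := by simp [hσ]
    have hb : b ∈ σ.1 \ ρ.1 := by simp [hσ]
    rw [mem_sdiff] at ha hb
    have hins : ∀ x, x ∈ σ.1 ∧ x ∉ ρ.1 → insert x ρ.1 ∈ K ∧ (insert x ρ.1).card = c + 1 :=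
      fun x hx => ⟨hK.2 σ.1 σ.2.1 _ (insert_subset hx.1 h), by
        rw [card_insert_of_notMem hx.2, ρ.2.2]⟩
    have hne : (⟨insert a ρ.1, hins a ha⟩ : Face K (c + 1)) ≠ ⟨insert b ρ.1, hins b hb⟩ := by
      intro h'
      have h2 : a ∈ insert b ρ.1 :=
        (Subtype.mk.inj h').subset (mem_insert_self a ρ.1)
      exact (mem_insert.1 h2).elim hab.ne ha.2
    have e1 : σ.1 = insert b (insert a ρ.1) := by
      rw [← sdiff_union_of_subset h, hσ]
      ext x; simp only [mem_union, mem_insert, mem_singleton]; tauto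
    rw [Fintype.sum_eq_add _ _ hne]
    · have e2 : σ.1 = insert a (insert b ρ.1) := by rw [e1, insert_comm]
      have := coeffD_diamond z ha.2 hb.2 hab
      rwa [← e1, ← e2] at this
    · rintro τ ⟨hτa, hτb⟩
      by_cases h1 : ρ.1 ⊆ τ.1
      · by_cases h2 : τ.1 ⊆ σ.1
        · exfalso
          obtain ⟨v, hv, hvτ⟩ : ∃ v, v ∉ ρ.1 ∧ insert v ρ.1 = τ.1 :=
            (covBy_iff_exists_insert.1 (covBy_iff_card_sdiff_eq_one.2
              ⟨h1, by rw [card_sdiff_of_subset h1, τ.2.2, ρ.2.2]; omega⟩))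
          have hvσ : v ∈ σ.1 \ ρ.1 :=
            mem_sdiff.2 ⟨h2 (hvτ ▸ mem_insert_self v ρ.1), hv⟩
          rw [hσ, mem_insert, mem_singleton] at hvσ
          rcases hvσ with rfl | rfl
          · exact hτa (Subtype.ext hvτ.symm)
          · exact hτb (Subtype.ext hvτ.symm)
        · rw [coeffD_of_not_subset z h2, mul_zero]
      · rw [coeffD_of_not_subset z h1, zero_mul]
  · refine sum_eq_zero fun τ _ => ?_
    by_cases h1 : ρ.1 ⊆ τ.1
    · rw [coeffD_of_not_subset z fun h2 => h (h1.trans h2), mul_zero]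
    · rw [coeffD_of_not_subset z h1, zero_mul]

theorem finrank_cyc_succ (K : Finset (Finset V)) (z : V → k) (m : ℕ) :
    Module.finrank k (cyc k K z (m + 1)) =
      Fintype.card (Face K (m + 1)) - (boundaryMatrix K z m).rank := by
  have := LinearMap.finrank_range_add_finrank_ker (tB k K z m)
  rw [Module.finrank_fintype_fun_eq_card] at this
  exact Nat.eq_sub_of_add_eq' this

/-- The faces of the link, with their cardinalities shifted by that of `σ`. -/
def linkFaceEquiv (L : Finset (Finset V)) (W σ : Finset V) (n : ℕ) :
    Face (linkIn L W σ) n ≃ LinkFace L W σ (n + σ.card) :=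
  Equiv.subtypeEquivRight fun _ => by rw [add_left_inj]

theorem rank_linkMatrix_add (L : Finset (Finset V)) (W σ : Finset V) {n c : ℕ}
    (hc : n + σ.card = c) :
    (linkMatrix k L W σ c).rank =
      (boundaryMatrix (linkIn L W σ) (fun _ => (1 : k)) n).rank := by
  subst hc
  let e' : Face (linkIn L W σ) (n + 1) ≃ LinkFace L W σ (n + σ.card + 1) :=
    Equiv.subtypeEquivRight fun _ => by rw [add_right_comm, add_left_inj]
  rw [← Matrix.rank_submatrix (linkMatrix k L W σ (n + σ.card)) e' (linkFaceEquiv L W σ n),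
    ← Matrix.rank_transpose]
  rfl

theorem isEmpty_linkFace (L : Finset (Finset V)) (W σ : Finset V) {c : ℕ} (hc : c < σ.card) :
    IsEmpty (LinkFace L W σ c) :=
  ⟨fun ρ => by have := ρ.2.2; omega⟩

theorem rank_linkMatrix_of_lt (L : Finset (Finset V)) (W σ : Finset V) {c : ℕ}
    (hc : c < σ.card) : (linkMatrix k L W σ c).rank = 0 := by
  have := isEmpty_linkFace L W σ hc
  have h := (linkMatrix k L W σ c).rank_le_card_width
  rw [Fintype.card_eq_zero] at h
  exact Nat.le_zero.1 h

/-- The rank of the block of the differential that ends in degree `i`. -/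
noncomputable def prevRank (k : Type) [Field k] (L : Finset (Finset V)) (W σ : Finset V) :
    ℕ → ℕ
  | 0 => 0
  | j + 1 => (linkMatrix k L W σ j).rank

theorem reducedBetti_linkIn_add {L : Finset (Finset V)} (hL : IsCx L) (W : Finset V)
    {σ : Finset V} (hσ : σ ∈ L) (i : ℕ) :
    reducedBetti k (linkIn L W σ) ((i : ℤ) - 1 - (σ.card : ℤ)) +
        ((linkMatrix k L W σ i).rank + prevRank k L W σ i) =
      Fintype.card (LinkFace L W σ i) := by
  rcases lt_or_ge i σ.card with h | h
  · have := isEmpty_linkFace L W σ h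
    rw [reducedBetti, if_pos (by omega), rank_linkMatrix_of_lt L W σ h, Fintype.card_eq_zero]
    cases i with
    | zero => rfl
    | succ j => rw [prevRank, rank_linkMatrix_of_lt L W σ (by omega)]
  · obtain ⟨n, rfl⟩ := Nat.exists_eq_add_of_le' h
    have hn : (((n + σ.card : ℕ) : ℤ) - 1 - (σ.card : ℤ) + 1).toNat = n := by omega
    rw [reducedBetti, if_neg (by omega), hn, rank_linkMatrix_add L W σ rfl,
      ← Fintype.card_congr (linkFaceEquiv L W σ n)]
    set K := linkIn L W σ
    have hK : IsCx K := isCx_linkIn hL W hσ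
    have hdef : twHomDim k K (fun _ => (1 : k)) n =
      Module.finrank k (cyc k K (fun _ => (1 : k)) n) -
        (boundaryMatrix K (fun _ => (1 : k)) n).rank := rfl
    rw [hdef]
    cases n with
    | zero =>
      have h0 : prevRank k L W σ (0 + σ.card) = 0 := by
        rw [zero_add]
        rcases hs : σ.card with _ | j
        · rfl
        · exact rank_linkMatrix_of_lt L W σ (by omega)
      have h1 : Module.finrank k (cyc k K (fun _ => (1 : k)) 0) = Fintype.card (Face K 0) := by
        rw [cyc, finrank_top, Module.finrank_fintype_fun_eq_card]
      have h2 : (boundaryMatrix K (fun _ => (1 : k)) 0).rank ≤ Fintype.card (Face K 0) :=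
        Matrix.rank_le_card_height _
      omega
    | succ m =>
      have h0 : prevRank k L W σ (m + 1 + σ.card) =
          (boundaryMatrix K (fun _ => (1 : k)) m).rank := by
        rw [add_right_comm, prevRank, rank_linkMatrix_add L W σ rfl]
      have h1 := finrank_cyc_succ K (fun _ => (1 : k)) m
      have h2 := Matrix.rank_add_rank_le_card_of_mul_eq_zero
        (boundaryMatrix_mul hK (fun _ => (1 : k)) m)
      omega

theorem aomotoBettiW_eq {L : Finset (Finset V)} (hL : IsCx L) (W : Finset V) (i : ℕ) :
    aomotoBettiW k L W i = Module.finrank k (LinearMap.ker (aD k L (zW k W) i)) -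
      ∑ σ ∈ L.filter (fun σ => Disjoint σ W), prevRank k L W σ i := by
  cases i with
  | zero =>
    simp only [prevRank, Finset.sum_const_zero]
    rfl
  | succ j => exact congrArg _ (finrank_range_aD_zW hL W j)

end Homology

/-- Hochster-type formula of Aramova--Avramov--Herzog.
`β_i(k⟨L⟩, W) = ∑_{σ ∈ L_{V∖W}} dim_k H̃_{i−1−|σ|}(lk_{L_W}(σ); k)`, the sum ranging
over all faces of `L` disjoint from `W` (including the empty face, with the usual
conventions). -/
theorem statement2 {V : Type} [Fintype V] [LinearOrder V] (k : Type) [Field k]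
    (L : Finset (Finset V)) (hL : IsCx L) (hV : ∀ v : V, {v} ∈ L)
    (W : Finset V) (i : ℕ) :
    aomotoBettiW k L W i =
      ∑ σ ∈ L.filter (fun σ => Disjoint σ W),
        reducedBetti k (linkIn L W σ) ((i : ℤ) - 1 - (σ.card : ℤ)) := by
  have hker := LinearMap.finrank_range_add_finrank_ker (aD k L (zW k W) i)
  rw [Module.finrank_fintype_fun_eq_card, card_face_eq_sum hL W, finrank_range_aD_zW hL] at hker
  have hsum := Finset.sum_congr rfl fun σ (hσ : σ ∈ L.filter fun σ => Disjoint σ W) =>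
    reducedBetti_linkIn_add (k := k) hL W (mem_filter.1 hσ).1 i
  rw [Finset.sum_add_distrib, Finset.sum_add_distrib] at hsum
  rw [aomotoBettiW_eq hL]
  omega
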